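/- Suppose Φ is not simply laced and let S ⊆ Ψ be an orthogonal subset. Let Φ = Φ_ℓ ⊔ Φ_s and S = S_ℓ ⊔ S_s be the partitions into long and short roots. Then: (a) Φ_S = Φ_{S_ℓ} ⊔ Φ_{S_s}; (b) Φ_{S_s} = S_s ∪ (−S_s); (c) Φ_{S_ℓ} ∩ Φ_ℓ = S_ℓ ∪ (−S_ℓ); (d) S_ℓ ∪ (−S_ℓ) = Φ_ℓ ∩ Φ_S and S_s ∪ (−S_s) = S_ℓ^⊥ ∩ Φ_S; (e) ℤS ∩ Φ⁺ = S. -/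

import Mathlib

open scoped RealInnerProductSpace
open Classical

noncomputable section

variable (V : Type) [NormedAddCommGroup V] [InnerProductSpace ℝ V]

/-- The reflection determined by a vector `α` (the identity map if `α = 0`),
as a linear endomorphism:  `x ↦ x - (2⟪x,α⟫/⟪α,α⟫) • α`. -/
def reflMap (α : V) : V →ₗ[ℝ] V where
  toFun x := x - (2 * ⟪x, α⟫ / ⟪α, α⟫) • α
  map_add' x y := by
    simp only [inner_add_left]
    rw [show 2 * (⟪x, α⟫ + ⟪y, α⟫) / ⟪α, α⟫
        = 2 * ⟪x, α⟫ / ⟪α, α⟫ + 2 * ⟪y, α⟫ / ⟪α, α⟫ by ring, add_smul]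
    abel
  map_smul' c x := by
    simp only [real_inner_smul_left, RingHom.id_apply, smul_sub]
    rw [show 2 * (c * ⟪x, α⟫) / ⟪α, α⟫ = c * (2 * ⟪x, α⟫ / ⟪α, α⟫) by ring,
      mul_smul]

lemma reflMap_apply (α x : V) :
    reflMap V α x = x - (2 * ⟪x, α⟫ / ⟪α, α⟫) • α := rfl

lemma reflMap_involutive (α : V) : ∀ x, reflMap V α (reflMap V α x) = x := by
  intro x
  by_cases h : (⟪α, α⟫ : ℝ) = 0
  · have h0 : α = 0 := inner_self_eq_zero.mp h
    simp [reflMap_apply, h0]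
  · rw [reflMap_apply, reflMap_apply, inner_sub_left, real_inner_smul_left,
      div_mul_cancel₀ _ h]
    rw [show ⟪x, α⟫ - 2 * ⟪x, α⟫ = -⟪x, α⟫ by ring]
    rw [show 2 * -⟪x, α⟫ / ⟪α, α⟫ = -(2 * ⟪x, α⟫ / ⟪α, α⟫) by ring, neg_smul]
    abel

/-- The reflection determined by a vector `α`, as a linear automorphism of `V`. -/
def sref (α : V) : V ≃ₗ[ℝ] V :=
  { reflMap V α with
    invFun := reflMap V α
    left_inv := reflMap_involutive V α
    right_inv := reflMap_involutive V α }

lemma sref_apply (α x : V) :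
    sref V α x = x - (2 * ⟪x, α⟫ / ⟪α, α⟫) • α := rfl

variable {V}

/-- The coroot `α^∨ = 2α/⟪α,α⟫` associated with a root `α`, under the identification of the
coweight space with `V` given by the inner product. -/
def coroot (α : V) : V := (2 / ⟪α, α⟫) • α

/-- The dimension of the `(-1)`-eigenspace of a linear automorphism. -/
def lamEig (σ : V ≃ₗ[ℝ] V) : ℕ :=
  Module.finrank ℝ (Module.End.eigenspace (σ : V →ₗ[ℝ] V) (-1))

/-- The action `s_α ∘ σ` of a simple reflection on an involution: `s_α σ` if `s_α` and `σ`
commute, and `s_α σ s_α` otherwise. -/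
def circAct (α : V) (σ : V ≃ₗ[ℝ] V) : V ≃ₗ[ℝ] V :=
  if sref V α * σ = σ * sref V α then sref V α * σ else sref V α * σ * sref V α

/-- A set of pairwise orthogonal vectors. -/
def OrthSet (S : Finset V) : Prop :=
  (↑S : Set V).Pairwise fun a b => ⟪a, b⟫ = 0

/-- The product `σ_S` of the (commuting) reflections in the elements of an orthogonal set
`S`. -/
def sigmaOf (S : Finset V) : V ≃ₗ[ℝ] V :=
  (S.toList.map (sref V)).prod

variable (V)

/-- A finite crystallographic reduced root system in the Euclidean space `V`,
together with a fixed choice of simple roots. -/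
structure RSD where
  /-- The set of roots. -/
  Φ : Finset V
  /-- The set of simple roots. -/
  Δ : Finset V
  nonzero : (0 : V) ∉ Φ
  span_top : Submodule.span ℝ (Φ : Set V) = ⊤
  reduced : ∀ α ∈ Φ, ∀ c : ℝ, c • α ∈ Φ → c = 1 ∨ c = -1
  crystal : ∀ α ∈ Φ, ∀ β ∈ Φ, ∃ n : ℤ, (n : ℝ) = 2 * ⟪β, α⟫ / ⟪α, α⟫
  reflClosed : ∀ α ∈ Φ, ∀ β ∈ Φ, sref V α β ∈ Φ
  Δ_sub : Δ ⊆ Φ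
  Δ_indep : LinearIndependent ℝ (fun x : (Δ : Set V) => (x : V))
  Δ_base : ∀ α ∈ Φ, (∃ c : V → ℕ, α = ∑ γ ∈ Δ, (c γ : ℝ) • γ) ∨
      (∃ c : V → ℕ, -α = ∑ γ ∈ Δ, (c γ : ℝ) • γ)

namespace RSD

variable {V}
variable (D : RSD V)

/-- The set of positive roots. -/
def Pos : Set V :=
  {α | α ∈ D.Φ ∧ ∃ c : V → ℕ, α = ∑ γ ∈ D.Δ, (c γ : ℝ) • γ}

/-- The set of negative roots. -/
def Neg : Set V := {α | -α ∈ D.Pos}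

/-- The Weyl group, as the subgroup of `GL(V)` generated by the simple reflections. -/
def W : Subgroup (V ≃ₗ[ℝ] V) := Subgroup.closure ((fun γ => sref V γ) '' ↑D.Δ)

/-- The length of `w`: the least number of simple reflections needed to write `w` as a
product of simple reflections. -/
def length (w : V ≃ₗ[ℝ] V) : ℕ :=
  sInf {n | ∃ l : List V, l.length = n ∧ (∀ γ ∈ l, γ ∈ D.Δ) ∧ w = (l.map (sref V)).prod}

/-- The Bruhat order on the Weyl group: `u ≤ v` iff `v` is obtained from `u` by successively
multiplying by reflections, each time increasing the length. -/
def ble (u v : V ≃ₗ[ℝ] V) : Prop :=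
  Relation.ReflTransGen
    (fun x y => (∃ β ∈ D.Φ, y = sref V β * x) ∧ D.length x < D.length y) u v

/-- The strict Bruhat order. -/
def blt (u v : V ≃ₗ[ℝ] V) : Prop := D.ble u v ∧ u ≠ v

/-- The dominance order: `y - x` is a nonnegative integer combination of simple roots. -/
def dom (x y : V) : Prop := ∃ c : V → ℕ, y - x = ∑ γ ∈ D.Δ, (c γ : ℝ) • γ

/-- The dominance order on coweights: `y - x` is a nonnegative integer combination of simple
coroots. -/
def cdom (x y : V) : Prop := ∃ c : V → ℕ, y - x = ∑ γ ∈ D.Δ, (c γ : ℝ) • coroot γ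

/-- The length `L(σ) = (ℓ(σ) + λ(σ))/2` of an involution `σ`, where `λ(σ)` is the dimension
of the `(-1)`-eigenspace of `σ`. -/
def Linv (σ : V ≃ₗ[ℝ] V) : ℚ :=
  ((D.length σ : ℚ) + (lamEig σ : ℚ)) / 2

end RSD

/-- A finite irreducible crystallographic reduced root system, with a fixed choice of simple
roots and a marked simple root `αP` whose coefficient in the highest root `θ` equals `1`
(the cominuscule case). -/
structure MRSD extends RSD V where
  irred : ¬ ∃ A B : Set V, A.Nonempty ∧ B.Nonempty ∧ A ∪ B = ↑Φ ∧
      ∀ α ∈ A, ∀ β ∈ B, ⟪α, β⟫ = 0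
  /-- The marked simple root. -/
  αP : V
  αP_mem : αP ∈ Δ
  /-- The highest root. -/
  θ : V
  θ_mem : θ ∈ Φ
  θ_high : ∀ α ∈ Φ, ∃ c : V → ℕ, θ - α = ∑ γ ∈ Δ, (c γ : ℝ) • γ
  θ_coeff : ∃ c : V → ℕ, (θ = ∑ γ ∈ Δ, (c γ : ℝ) • γ) ∧ c αP = 1

namespace MRSD

variable {V}
variable (M : MRSD V)

/-- The set `Ψ` of positive roots in which the marked simple root `αP` has coefficient `1`. -/
def Psi : Set V :=
  {α | α ∈ M.Φ ∧ ∃ c : V → ℕ, (α = ∑ γ ∈ M.Δ, (c γ : ℝ) • γ) ∧ c M.αP = 1}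

/-- The set of positive roots of the subsystem `Φ_P`, i.e. the positive roots in which the
marked simple root `αP` has coefficient `0`. -/
def PosP : Set V :=
  {α | α ∈ M.Φ ∧ ∃ c : V → ℕ, (α = ∑ γ ∈ M.Δ, (c γ : ℝ) • γ) ∧ c M.αP = 0}

/-- The parabolic subgroup `W_P` generated by the simple reflections in `Δ ∖ {αP}`. -/
def WP : Subgroup (V ≃ₗ[ℝ] V) :=
  Subgroup.closure ((fun γ => sref V γ) '' ↑(M.Δ.erase M.αP))

/-- The inversion set `Φ⁺(v) = {α ∈ Φ⁺ : v(α) ∈ Φ⁻}`. -/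
def InvSet (v : V ≃ₗ[ℝ] V) : Set V := {α | α ∈ M.Pos ∧ v α ∈ M.Neg}

/-- `v` belongs to `W^P`: it lies in `W` and has minimal length in its coset `v W_P`. -/
def IsMinRep (v : V ≃ₗ[ℝ] V) : Prop :=
  v ∈ M.W ∧ ∀ u, u ∈ M.W → v⁻¹ * u ∈ M.WP → M.length v ≤ M.length u

/-- `μ` is the minimal length representative `[w]^P` of the coset `w W_P`. -/
def IsMinRepOf (μ w : V ≃ₗ[ℝ] V) : Prop :=
  (μ ∈ M.W ∧ w⁻¹ * μ ∈ M.WP) ∧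
    ∀ u, u ∈ M.W → w⁻¹ * u ∈ M.WP → M.length μ ≤ M.length u

/-- The subset `Φ_S = {α ∈ Φ : σ_S(α) = -α}` determined by an orthogonal set of roots `S`. -/
def PhiSet (S : Finset V) : Set V := {α | α ∈ M.Φ ∧ sigmaOf S α = -α}

/-- A root is long if its squared length is maximal among the roots. -/
def IsLong (α : V) : Prop := ∀ β ∈ M.Φ, ⟪β, β⟫ ≤ ⟪α, α⟫

/-- Admissible pair: `v ∈ W^P`, `S ⊆ Ψ` a set of pairwise orthogonal roots with
`v(S) ⊆ Φ⁻`. -/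
def Admissible (v : V ≃ₗ[ℝ] V) (S : Finset V) : Prop :=
  M.IsMinRep v ∧ (↑S : Set V) ⊆ M.Psi ∧ OrthSet S ∧ ∀ β ∈ S, v β ∈ M.Neg

/-- The length `L(v,S) = (ℓ(σ_{v(S)}) + |S|)/2` of an admissible pair `(v,S)`. -/
def pairL (v : V ≃ₗ[ℝ] V) (S : Finset V) : ℚ :=
  ((M.length (sigmaOf (S.image fun x => v x)) : ℚ) + (S.card : ℚ)) / 2

end MRSD

section RootLemmas

lemma OrthSet.mono {V : Type} [NormedAddCommGroup V] [InnerProductSpace ℝ V]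
    {S T : Finset V} (hS : OrthSet S) (hTS : T ⊆ S) : OrthSet T :=
  Set.Pairwise.mono (Finset.coe_subset.mpr hTS) hS

lemma OrthSet.inner_sum {V : Type} [NormedAddCommGroup V] [InnerProductSpace ℝ V]
    {S : Finset V} (hS : OrthSet S) (c : V → ℝ) {β : V} (hβ : β ∈ S) :
    ⟪∑ γ ∈ S, c γ • γ, β⟫ = c β * ⟪β, β⟫ := by
  rw [sum_inner, Finset.sum_eq_single_of_mem β hβ]
  · exact real_inner_smul_left _ _ _
  · intro γ hγ hne
    rw [real_inner_smul_left, hS hγ hβ hne, mul_zero]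

lemma prod_sref_apply {V : Type} [NormedAddCommGroup V] [InnerProductSpace ℝ V]
    (l : List V) (hl : l.Pairwise fun a b => (⟪a, b⟫ : ℝ) = 0) (x : V) :
    (l.map (sref V)).prod x = x - (l.map fun β => (2 * ⟪x, β⟫ / ⟪β, β⟫) • β).sum := by
  induction l with
  | nil => simp
  | cons a l ih =>
    rw [List.pairwise_cons] at hl
    have hz : ∀ m : List V, (∀ b ∈ m, (⟪a, b⟫ : ℝ) = 0) →
        (⟪(m.map fun β => (2 * ⟪x, β⟫ / ⟪β, β⟫) • β).sum, a⟫ : ℝ) = 0 := by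
      intro m
      induction m with
      | nil => simp
      | cons b m ihm =>
        intro hm
        rw [List.map_cons, List.sum_cons, inner_add_left, real_inner_smul_left,
          real_inner_comm a b, hm b (by simp), ihm fun b' hb' => hm b' (by simp [hb'])]
        simp
    rw [List.map_cons, List.prod_cons, LinearEquiv.mul_apply, ih hl.2, sref_apply,
      inner_sub_left, hz l hl.1, sub_zero, List.map_cons, List.sum_cons]
    abel

lemma sigmaOf_apply {V : Type} [NormedAddCommGroup V] [InnerProductSpace ℝ V]
    {S : Finset V} (hS : OrthSet S) (x : V) :
    sigmaOf S x = x - ∑ β ∈ S, (2 * ⟪x, β⟫ / ⟪β, β⟫) • β := by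
  rw [sigmaOf, prod_sref_apply, Finset.sum_map_toList]
  refine S.nodup_toList.imp_of_mem ?_
  intro a b ha hb hab
  exact hS (Finset.mem_toList.mp ha) (Finset.mem_toList.mp hb) hab

lemma sigmaOf_eq_neg_iff {V : Type} [NormedAddCommGroup V] [InnerProductSpace ℝ V]
    {S : Finset V} (hS : OrthSet S) (h0 : (0 : V) ∉ S) (x : V) :
    sigmaOf S x = -x ↔ x ∈ Submodule.span ℝ (S : Set V) := by
  rw [sigmaOf_apply hS]
  constructor
  · intro h
    have h2 : x = (1 / 2 : ℝ) • ∑ β ∈ S, (2 * ⟪x, β⟫ / ⟪β, β⟫) • β := by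
      have h3 : ∑ β ∈ S, (2 * ⟪x, β⟫ / ⟪β, β⟫) • β = (2 : ℝ) • x := by
        rw [sub_eq_iff_eq_add] at h
        rw [two_smul]
        nth_rewrite 2 [h]
        abel
      rw [h3, smul_smul]
      norm_num
    rw [h2]
    exact Submodule.smul_mem _ _ (Submodule.sum_mem _ fun β hβ =>
      Submodule.smul_mem _ _ (Submodule.subset_span hβ))
  · intro h
    obtain ⟨c, -, hc⟩ := Submodule.mem_span_finset.mp h
    have h3 : ∑ β ∈ S, (2 * ⟪x, β⟫ / ⟪β, β⟫) • β = (2 : ℝ) • x := by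
      rw [← hc, Finset.smul_sum]
      refine Finset.sum_congr rfl fun β hβ => ?_
      have hβ0 : (⟪β, β⟫ : ℝ) ≠ 0 := fun h => h0 (inner_self_eq_zero.mp h ▸ hβ)
      rw [hS.inner_sum c hβ, smul_smul]
      congr 1
      field_simp
    rw [h3, two_smul]
    abel

namespace RSD

variable {V : Type} [NormedAddCommGroup V] [InnerProductSpace ℝ V] (D : RSD V)

lemma inner_self_pos {α : V} (hα : α ∈ D.Φ) : (0 : ℝ) < ⟪α, α⟫ :=
  real_inner_self_pos.mpr fun h => D.nonzero (h ▸ hα)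

lemma neg_mem {α : V} (hα : α ∈ D.Φ) : -α ∈ D.Φ := by
  have h := D.reflClosed α hα α hα
  rw [sref_apply, mul_div_assoc, div_self (D.inner_self_pos hα).ne', mul_one, two_smul] at h
  simpa using h

lemma inner_sref (α x : V) (hα : α ∈ D.Φ) :
    (⟪sref V α x, sref V α x⟫ : ℝ) = ⟪x, x⟫ := by
  have h := (D.inner_self_pos hα).ne'
  rw [sref_apply, inner_sub_left, inner_sub_right, inner_sub_right]
  simp only [real_inner_smul_left, real_inner_smul_right]
  rw [real_inner_comm x α]
  field_simp
  ring

/-- The coefficient of a fixed simple root, extended to a linear functional. -/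
lemma exists_coeff {γ₀ : V} (hγ₀ : γ₀ ∈ D.Δ) :
    ∃ f : V →ₗ[ℝ] ℝ, ∀ c : V → ℕ, f (∑ γ ∈ D.Δ, (c γ : ℝ) • γ) = c γ₀ := by
  have hΔ : LinearIndepOn ℝ id (D.Δ : Set V) := D.Δ_indep
  let b := Module.Basis.extend hΔ
  refine ⟨b.constr ℝ fun γ => if (γ : V) = γ₀ then 1 else 0, fun c => ?_⟩
  have hval : ∀ γ ∈ D.Δ, b.constr ℝ (fun γ => if (γ : V) = γ₀ then (1 : ℝ) else 0) γ =
      if γ = γ₀ then 1 else 0 := by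
    intro γ hγ
    have hmem : γ ∈ hΔ.extend (Set.subset_univ _) :=
      hΔ.subset_extend _ (by simpa using hγ)
    have h := b.constr_basis ℝ (fun γ => if (γ : V) = γ₀ then (1 : ℝ) else 0) ⟨γ, hmem⟩
    rwa [Module.Basis.extend_apply_self] at h
  rw [map_sum, Finset.sum_eq_single_of_mem γ₀ hγ₀]
  · rw [map_smul, hval γ₀ hγ₀, if_pos rfl, smul_eq_mul, mul_one]
  · intro γ hγ hne
    rw [map_smul, hval γ hγ, if_neg hne, smul_zero]

/-- If `α` is a root in the span of an orthogonal set of roots, the signs of its coefficients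
may be changed. -/
lemma sum_abs_mem {S : Finset V} (hSΦ : S ⊆ D.Φ) (hS : OrthSet S) (c : V → ℝ)
    (h : ∑ β ∈ S, c β • β ∈ D.Φ) : ∑ β ∈ S, |c β| • β ∈ D.Φ := by
  have key : ∀ T ⊆ S, ∑ β ∈ S, (if β ∈ T then -c β else c β) • β ∈ D.Φ := by
    intro T
    induction T using Finset.induction_on with
    | empty => simpa using h
    | insert a T ha ih =>
      intro hT
      have haS : a ∈ S := hT (Finset.mem_insert_self a T)
      have h1 := D.reflClosed a (hSΦ haS) _
        (ih fun x hx => hT (Finset.mem_insert_of_mem hx))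
      have h0 := (D.inner_self_pos (hSΦ haS)).ne'
      rw [sref_apply, hS.inner_sum _ haS, if_neg ha, ← mul_assoc,
        mul_div_cancel_right₀ _ h0] at h1
      convert h1 using 1
      rw [← Finset.add_sum_erase S _ haS, ← Finset.add_sum_erase S _ haS,
        if_pos (Finset.mem_insert_self a T), if_neg ha]
      have h2 : ∑ x ∈ S.erase a, (if x ∈ insert a T then -c x else c x) • x =
          ∑ x ∈ S.erase a, (if x ∈ T then -c x else c x) • x := by
        refine Finset.sum_congr rfl fun x hx => ?_
        simp [Finset.mem_insert, Finset.ne_of_mem_erase hx]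
      rw [h2]
      module
  have h1 := key (S.filter fun β => c β < 0) (Finset.filter_subset _ _)
  convert h1 using 1
  refine Finset.sum_congr rfl fun β hβ => ?_
  congr 1
  split_ifs with hc
  · exact abs_of_neg (Finset.mem_filter.mp hc).2
  · refine abs_of_nonneg (not_lt.mp fun h => hc (Finset.mem_filter.mpr ⟨hβ, h⟩))

/-- The squared lengths of two non-orthogonal roots, one strictly longer than the other,
have ratio `2` or `3`. -/
lemma inner_self_ratio {α β : V} (hα : α ∈ D.Φ) (hβ : β ∈ D.Φ) (hne : (⟪α, β⟫ : ℝ) ≠ 0)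
    (hlt : (⟪α, α⟫ : ℝ) < ⟪β, β⟫) :
    (⟪β, β⟫ : ℝ) = 2 * ⟪α, α⟫ ∨ (⟪β, β⟫ : ℝ) = 3 * ⟪α, α⟫ := by
  obtain ⟨m, hm⟩ := D.crystal α hα β hβ
  obtain ⟨n, hn⟩ := D.crystal β hβ α hα
  have ha := D.inner_self_pos hα
  have hb := D.inner_self_pos hβ
  rw [real_inner_comm] at hm
  rw [eq_div_iff ha.ne'] at hm
  rw [eq_div_iff hb.ne'] at hn
  set x : ℝ := ⟪α, β⟫
  set a : ℝ := ⟪α, α⟫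
  set b : ℝ := ⟪β, β⟫
  have hcs : x * x ≤ a * b := real_inner_mul_inner_self_le α β
  have hmn : (m : ℝ) * a = n * b := by rw [hm, hn]
  have hn0 : n ≠ 0 := by
    rintro rfl
    apply hne
    simpa using hn.symm
  have h4 : (m * n : ℝ) ≤ 4 := by
    have : (m * n : ℝ) * (a * b) ≤ 4 * (a * b) := by
      calc (m * n : ℝ) * (a * b) = (m * a) * (n * b) := by ring
        _ = 4 * (x * x) := by rw [hm, hn]; ring
        _ ≤ _ := by linarith
    exact le_of_mul_le_mul_right this (mul_pos ha hb)
  have h4' : m * n ≤ 4 := by exact_mod_cast h4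
  have hsq : (n : ℝ) * n < m * n := by
    have h1 : (n : ℝ) * n * a < (m * n) * a := by
      have : (0 : ℝ) < n * n := mul_self_pos.mpr (Int.cast_ne_zero.mpr hn0)
      calc (n : ℝ) * n * a < n * n * b := by gcongr
        _ = m * n * a := by linear_combination -(n : ℝ) * hmn
    exact lt_of_mul_lt_mul_right h1 ha.le
  have hsq' : n * n < m * n := by exact_mod_cast hsq
  have hn2 : n = 1 ∨ n = -1 := by
    have h1 : n < 2 := by nlinarith
    have h2 : -2 < n := by nlinarith
    omega
  have fin : ∀ k : ℤ, b = k * a → k ≤ 4 → 1 < k → b ≠ 4 * a → b = 2 * a ∨ b = 3 * a := by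
    intro k hk h1 h2 h3
    interval_cases k
    · left; exact_mod_cast hk
    · right; exact_mod_cast hk
    · exact absurd (by exact_mod_cast hk) h3
  have hb4 : b ≠ 4 * a := by
    intro hb4
    have hxx : x * x = a * b := by
      have h1 : (n : ℝ) * n = 1 := by rcases hn2 with rfl | rfl <;> norm_num
      have h2 : (n : ℝ) * n * (b * b) = 4 * (x * x) := by
        linear_combination (n * b + 2 * x) * hn
      rw [h1] at h2
      linear_combination (-1 / 4 : ℝ) * h2 + b / 4 * hb4
    have h5 : β = (x / a) • α := by
      have : (⟪β - (x / a) • α, β - (x / a) • α⟫ : ℝ) = 0 := by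
        rw [inner_sub_left, inner_sub_right, inner_sub_right]
        simp only [real_inner_smul_left, real_inner_smul_right]
        rw [real_inner_comm α β]
        change b - x / a * x - (x / a * x - x / a * (x / a * a)) = 0
        field_simp
        linarith
      exact sub_eq_zero.mp (inner_self_eq_zero.mp this)
    have h6 := D.reduced α hα _ (h5 ▸ hβ)
    have h7 : b = a := by
      have h8 : x = a ∨ x = -a := by
        rcases h6 with h | h
        · left; field_simp at h; exact h
        · right; field_simp at h; exact h
      have h9 : x * x = a * a := by rcases h8 with h | h <;> rw [h] <;> ring
      rw [hxx] at h9
      exact mul_left_cancel₀ ha.ne' h9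
    exact hlt.ne' h7
  rcases hn2 with rfl | rfl
  · exact fin m (by push_cast at hmn; linarith) (by linarith) (by linarith) hb4
  · exact fin (-m) (by push_cast at hmn ⊢; linarith) (by linarith) (by linarith) hb4

end RSD

namespace MRSD

variable {V : Type} [NormedAddCommGroup V] [InnerProductSpace ℝ V] (M : MRSD V)

lemma exists_inner_ne_zero {β γ : V} (hβ : β ∈ M.Φ) (hγ : γ ∈ M.Φ) :
    ∃ γ' ∈ M.Φ, (⟪γ', γ'⟫ : ℝ) = ⟪γ, γ⟫ ∧ (⟪β, γ'⟫ : ℝ) ≠ 0 := by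
  by_contra! hcon
  apply M.irred
  refine ⟨{δ | δ ∈ M.Φ ∧ ∃ γ' ∈ M.Φ, (⟪γ', γ'⟫ : ℝ) = ⟪γ, γ⟫ ∧ (⟪δ, γ'⟫ : ℝ) ≠ 0},
    {δ | δ ∈ M.Φ ∧ ∀ γ' ∈ M.Φ, (⟪γ', γ'⟫ : ℝ) = ⟪γ, γ⟫ → (⟪δ, γ'⟫ : ℝ) = 0},
    ⟨γ, hγ, γ, hγ, rfl, (M.inner_self_pos hγ).ne'⟩, ⟨β, hβ, hcon⟩, ?_, ?_⟩
  · ext δ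
    constructor
    · rintro (h | h) <;> exact h.1
    · intro h
      by_cases h1 : ∃ γ' ∈ M.Φ, (⟪γ', γ'⟫ : ℝ) = ⟪γ, γ⟫ ∧ (⟪δ, γ'⟫ : ℝ) ≠ 0
      · exact Or.inl ⟨h, h1⟩
      · push Not at h1
        exact Or.inr ⟨h, h1⟩
  · rintro α ⟨hα, γ', hγ', hlen, hne⟩ δ ⟨-, hδ⟩
    have h1 := hδ γ' hγ' hlen
    have h2 := hδ _ (M.reflClosed α hα γ' hγ') ((M.inner_sref α γ' hα).trans hlen)
    rw [sref_apply, inner_sub_right, real_inner_smul_right, h1, zero_sub, neg_eq_zero,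
      real_inner_comm α γ'] at h2
    have ha := (M.inner_self_pos hα).ne'
    rcases mul_eq_zero.mp h2 with h | h
    · exact absurd h (div_ne_zero (mul_ne_zero two_ne_zero hne) ha)
    · rw [real_inner_comm]
      exact h

/-- A root whose squared length is twice that of another root is long. -/
lemma isLong_of_inner_self_eq_two_mul {α β : V} (hα : α ∈ M.Φ) (hβ : β ∈ M.Φ)
    (h : (⟪β, β⟫ : ℝ) = 2 * ⟪α, α⟫) : M.IsLong β := by
  intro γ hγ
  by_contra! hlt
  have ha := M.inner_self_pos hα
  obtain ⟨γ₁, h1, hl1, hn1⟩ := M.exists_inner_ne_zero hα hγ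
  obtain ⟨γ₂, h2, hl2, hn2⟩ := M.exists_inner_ne_zero hβ hγ
  have r1 := M.inner_self_ratio hα h1 hn1 (by rw [hl1]; linarith)
  have r2 := M.inner_self_ratio hβ h2 hn2 (by rw [hl2]; linarith)
  rw [hl1] at r1
  rw [hl2] at r2
  rcases r1 with r1 | r1 <;> rcases r2 with r2 | r2 <;> linarith

lemma isLong_neg {α : V} : M.IsLong (-α) ↔ M.IsLong α := by
  simp [IsLong]

lemma exists_coeff_functional : ∃ f : V →ₗ[ℝ] ℝ, (∀ α ∈ M.Psi, f α = 1) ∧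
    (∀ α ∈ M.Pos, 0 ≤ f α) ∧ ∀ α ∈ M.Φ, -1 ≤ f α ∧ f α ≤ 1 := by
  obtain ⟨f, hf⟩ := M.exists_coeff M.αP_mem
  have hle : ∀ α ∈ M.Φ, f α ≤ 1 := by
    intro α hα
    obtain ⟨c, hc⟩ := M.θ_high α hα
    obtain ⟨d, hd, hd1⟩ := M.θ_coeff
    have h1 : f M.θ = 1 := by rw [hd, hf, hd1, Nat.cast_one]
    have h2 : f M.θ - f α = c M.αP := by rw [← map_sub, hc, hf]
    have h3 : (0 : ℝ) ≤ c M.αP := Nat.cast_nonneg _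
    linarith
  refine ⟨f, ?_, ?_, fun α hα => ⟨?_, hle α hα⟩⟩
  · rintro α ⟨-, c, hc, hc1⟩
    rw [hc, hf, hc1, Nat.cast_one]
  · rintro α ⟨-, c, hc⟩
    rw [hc, hf]
    exact Nat.cast_nonneg _
  · have := hle _ (M.neg_mem hα)
    rw [map_neg] at this
    linarith

/-- If half the sum of two orthogonal elements of `Ψ` is a root, then the two elements have the
same length. -/
lemma inner_self_eq_of_half_sum_mem {β β' : V} (hβ : β ∈ M.Psi) (hβ' : β' ∈ M.Psi)
    (horth : (⟪β, β'⟫ : ℝ) = 0) (h : (1 / 2 : ℝ) • (β + β') ∈ M.Φ) :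
    (⟪β, β⟫ : ℝ) = ⟪β', β'⟫ := by
  obtain ⟨f, hf1, -, hf3⟩ := M.exists_coeff_functional
  have horth' : (⟪β', β⟫ : ℝ) = 0 := by rw [real_inner_comm]; exact horth
  set a := (1 / 2 : ℝ) • (β + β') with ha
  have hfa : f a = 1 := by
    rw [ha, map_smul, map_add, hf1 β hβ, hf1 β' hβ']
    norm_num
  have hle : ∀ γ ∈ M.Psi, 2 * (⟪γ, a⟫ : ℝ) ≤ 2 * ⟪a, a⟫ := by
    intro γ hγ
    have h1 := (hf3 _ (M.reflClosed a h γ hγ.1)).1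
    rw [sref_apply, map_sub, map_smul, hf1 γ hγ, hfa, smul_eq_mul, mul_one] at h1
    have h2 : 2 * (⟪γ, a⟫ : ℝ) / ⟪a, a⟫ ≤ 2 := by linarith
    exact (div_le_iff₀ (M.inner_self_pos h)).mp h2
  have h1 := hle β hβ
  have h2 := hle β' hβ'
  simp only [ha, inner_add_left, inner_add_right, real_inner_smul_left,
    real_inner_smul_right, horth, horth'] at h1 h2
  linarith

/-- A root in the span of an orthogonal set `S ⊆ Ψ` is either an element of `S` up to sign, or
a short root which is half of a signed sum of two long elements of `S`. -/
lemma root_in_span_cases {S : Finset V} (hS : (↑S : Set V) ⊆ M.Psi) (horth : OrthSet S)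
    (c : V → ℝ) {α : V} (hα : α ∈ M.Φ) (hc : α = ∑ β ∈ S, c β • β) :
    (∃ β ∈ S, α = β ∨ α = -β) ∨
    ∃ β ∈ S, ∃ β' ∈ S, M.IsLong β ∧ M.IsLong β' ∧ ¬ M.IsLong α ∧
      |c β| = 1 / 2 ∧ α = c β • β + c β' • β' := by
  have hSΦ : S ⊆ M.Φ := fun β hβ => (hS hβ).1
  obtain ⟨f, hf1, -, hf3⟩ := M.exists_coeff_functional
  have habs := M.sum_abs_mem hSΦ horth c (hc ▸ hα)
  have hsum : ∑ β ∈ S, |c β| ≤ 1 := by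
    have h1 := (hf3 _ habs).2
    rw [map_sum] at h1
    refine le_of_eq_of_le (Finset.sum_congr rfl fun β hβ => ?_) h1
    rw [map_smul, hf1 β (hS hβ), smul_eq_mul, mul_one]
  have hhalf : ∀ β ∈ S, c β ≠ 0 → 1 / 2 ≤ |c β| := by
    intro β hβ h0
    obtain ⟨n, hn⟩ := M.crystal β (hSΦ hβ) α hα
    rw [hc, horth.inner_sum c hβ, ← mul_assoc,
      mul_div_cancel_right₀ _ (M.inner_self_pos (hSΦ hβ)).ne'] at hn
    have hn0 : n ≠ 0 := by
      rintro rfl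
      apply h0
      simpa using hn.symm
    have h1 : (1 : ℝ) ≤ |(n : ℝ)| := by exact_mod_cast Int.one_le_abs hn0
    rw [hn, abs_mul, abs_two] at h1
    linarith
  have hex : ∃ β ∈ S, c β ≠ 0 := by
    by_contra! h
    apply M.nonzero
    rw [hc, Finset.sum_eq_zero fun β hβ => by rw [h β hβ, zero_smul]] at hα
    exact hα
  obtain ⟨β, hβ, hβ0⟩ := hex
  by_cases h : ∃ β' ∈ S, β' ≠ β ∧ c β' ≠ 0
  · right
    obtain ⟨β', hβ', hne, hβ'0⟩ := h
    have hβ'e : β' ∈ S.erase β := Finset.mem_erase.mpr ⟨hne, hβ'⟩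
    have hsplit : ∀ {A : Type} [AddCommMonoid A] (g : V → A),
        ∑ x ∈ S, g x = g β + (g β' + ∑ x ∈ (S.erase β).erase β', g x) := fun g => by
      rw [Finset.add_sum_erase _ _ hβ'e, Finset.add_sum_erase _ _ hβ]
    have e1 := hhalf β hβ hβ0
    have e2 := hhalf β' hβ' hβ'0
    have hnn : 0 ≤ ∑ x ∈ (S.erase β).erase β', |c x| :=
      Finset.sum_nonneg fun _ _ => abs_nonneg _
    have hs := hsum
    rw [hsplit] at hs
    have d1 : |c β| = 1 / 2 := by linarith
    have d2 : |c β'| = 1 / 2 := by linarith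
    have hz : ∀ x ∈ (S.erase β).erase β', c x = 0 := by
      have h0 : ∑ x ∈ (S.erase β).erase β', |c x| = 0 := by linarith
      intro x hx
      exact abs_eq_zero.mp
        ((Finset.sum_eq_zero_iff_of_nonneg fun _ _ => abs_nonneg _).mp h0 x hx)
    have hαe : α = c β • β + c β' • β' := by
      rw [hc, hsplit, Finset.sum_eq_zero fun x hx => by rw [hz x hx, zero_smul], add_zero]
    have hmem : (1 / 2 : ℝ) • (β + β') ∈ M.Φ := by
      rw [hsplit, Finset.sum_eq_zero fun x hx => by rw [hz x hx, abs_zero, zero_smul],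
        add_zero, d1, d2, ← smul_add] at habs
      exact habs
    have ho : (⟪β, β'⟫ : ℝ) = 0 := horth hβ hβ' hne.symm
    have ho' : (⟪β', β⟫ : ℝ) = 0 := horth hβ' hβ hne
    have hlen := M.inner_self_eq_of_half_sum_mem (hS hβ) (hS hβ') ho hmem
    have q1 : c β * c β = 1 / 4 := by rw [← abs_mul_abs_self, d1]; norm_num
    have q2 : c β' * c β' = 1 / 4 := by rw [← abs_mul_abs_self, d2]; norm_num
    have hαα : (⟪β, β⟫ : ℝ) = 2 * ⟪α, α⟫ := by
      rw [hαe]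
      simp only [inner_add_left, inner_add_right, real_inner_smul_left,
        real_inner_smul_right, ho, ho', ← hlen]
      linear_combination (-2 * ⟪β, β⟫) * q1 + (-2 * ⟪β, β⟫) * q2
    refine ⟨β, hβ, β', hβ', M.isLong_of_inner_self_eq_two_mul hα (hSΦ hβ) hαα,
      M.isLong_of_inner_self_eq_two_mul hα (hSΦ hβ') (hlen ▸ hαα), ?_, d1, hαe⟩
    intro hl
    have := hl β (hSΦ hβ)
    have := M.inner_self_pos hα
    linarith
  · left
    push Not at h
    have hαe : α = c β • β := by
      rw [hc]
      refine Finset.sum_eq_single_of_mem β hβ fun x hx hne => ?_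
      rw [h x hx hne, zero_smul]
    refine ⟨β, hβ, ?_⟩
    rcases M.reduced β (hSΦ hβ) (c β) (hαe ▸ hα) with h1 | h1
    · left
      rw [hαe, h1, one_smul]
    · right
      rw [hαe, h1, neg_smul, one_smul]

lemma mem_PhiSet_iff {S : Finset V} (hS : (↑S : Set V) ⊆ M.Psi) (horth : OrthSet S) (α : V) :
    α ∈ M.PhiSet S ↔ α ∈ M.Φ ∧ α ∈ Submodule.span ℝ (S : Set V) :=
  and_congr_right fun _ =>
    sigmaOf_eq_neg_iff horth (fun h => M.nonzero (hS h).1) α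

lemma PhiSet_mono {S T : Finset V} (hS : (↑S : Set V) ⊆ M.Psi) (horth : OrthSet S)
    (hTS : T ⊆ S) : M.PhiSet T ⊆ M.PhiSet S := by
  intro α hα
  rw [M.mem_PhiSet_iff ((Finset.coe_subset.mpr hTS).trans hS) (horth.mono hTS)] at hα
  rw [M.mem_PhiSet_iff hS horth]
  exact ⟨hα.1, Submodule.span_mono (Finset.coe_subset.mpr hTS) hα.2⟩

lemma mem_PhiSet_of_mem_or_neg_mem {S : Finset V} (hS : (↑S : Set V) ⊆ M.Psi)
    (horth : OrthSet S) {α : V} (hα : α ∈ S ∨ -α ∈ S) : α ∈ M.PhiSet S := by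
  rw [M.mem_PhiSet_iff hS horth]
  rcases hα with h | h
  · exact ⟨(hS h).1, Submodule.subset_span h⟩
  · rw [← neg_neg α]
    exact ⟨M.neg_mem (hS h).1, Submodule.neg_mem _ (Submodule.subset_span h)⟩

lemma PhiSet_cases {S : Finset V} (hS : (↑S : Set V) ⊆ M.Psi) (horth : OrthSet S) {α : V}
    (hα : α ∈ M.PhiSet S) :
    (α ∈ S ∨ -α ∈ S) ∨
    ¬ M.IsLong α ∧ α ∈ M.PhiSet (S.filter fun α => M.IsLong α) ∧
      ∃ β ∈ S, M.IsLong β ∧ (⟪α, β⟫ : ℝ) ≠ 0 := by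
  rw [M.mem_PhiSet_iff hS horth] at hα
  obtain ⟨hαΦ, hspan⟩ := hα
  obtain ⟨c, -, hc⟩ := Submodule.mem_span_finset.mp hspan
  rcases M.root_in_span_cases hS horth c hαΦ hc.symm with
    ⟨β, hβ, rfl | rfl⟩ | ⟨β, hβ, β', hβ', hl, hl', hs, hcβ, hαe⟩
  · exact Or.inl (Or.inl hβ)
  · exact Or.inl (Or.inr (by rwa [neg_neg]))
  · refine Or.inr ⟨hs, ?_, β, hβ, hl, ?_⟩
    · have hsub : S.filter (fun α => M.IsLong α) ⊆ S := Finset.filter_subset _ _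
      rw [M.mem_PhiSet_iff ((Finset.coe_subset.mpr hsub).trans hS) (horth.mono hsub)]
      refine ⟨hαΦ, ?_⟩
      rw [hαe]
      exact Submodule.add_mem _
        (Submodule.smul_mem _ _ (Submodule.subset_span (Finset.mem_filter.mpr ⟨hβ, hl⟩)))
        (Submodule.smul_mem _ _ (Submodule.subset_span (Finset.mem_filter.mpr ⟨hβ', hl'⟩)))
    · rw [← hc, horth.inner_sum c hβ]
      refine mul_ne_zero ?_ (M.inner_self_pos (hS hβ).1).ne'
      intro h0
      rw [h0, abs_zero] at hcβ
      norm_num at hcβ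

end MRSD

end RootLemmas

/-- Suppose `Φ` is not simply laced and `S ⊆ Ψ` is orthogonal; write
`S = S_ℓ ⊔ S_s` and `Φ = Φ_ℓ ⊔ Φ_s` for the partitions into long and short roots.  Then:
(a) `Φ_S = Φ_{S_ℓ} ⊔ Φ_{S_s}`; (b) `Φ_{S_s} = S_s ∪ (-S_s)`;
(c) `Φ_{S_ℓ} ∩ Φ_ℓ = S_ℓ ∪ (-S_ℓ)`; (d) `S_ℓ ∪ (-S_ℓ) = Φ_ℓ ∩ Φ_S` and
`S_s ∪ (-S_s) = S_ℓ^⊥ ∩ Φ_S`; (e) `ℤS ∩ Φ⁺ = S`. -/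
theorem statement16 {V : Type} [NormedAddCommGroup V] [InnerProductSpace ℝ V]
    [FiniteDimensional ℝ V]
    (M : MRSD V) (hnsl : ∃ α ∈ M.Φ, ∃ β ∈ M.Φ, (⟪α, α⟫ : ℝ) ≠ ⟪β, β⟫)
    (S : Finset V) (hS : (↑S : Set V) ⊆ M.Psi) (horth : OrthSet S) :
    (M.PhiSet S =
        M.PhiSet (S.filter fun α => M.IsLong α) ∪ M.PhiSet (S.filter fun α => ¬ M.IsLong α) ∧
      Disjoint (M.PhiSet (S.filter fun α => M.IsLong α))
        (M.PhiSet (S.filter fun α => ¬ M.IsLong α))) ∧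
    (M.PhiSet (S.filter fun α => ¬ M.IsLong α) =
      {α : V | α ∈ S.filter (fun α => ¬ M.IsLong α) ∨ -α ∈ S.filter (fun α => ¬ M.IsLong α)}) ∧
    (M.PhiSet (S.filter fun α => M.IsLong α) ∩ {α : V | α ∈ M.Φ ∧ M.IsLong α} =
      {α : V | α ∈ S.filter (fun α => M.IsLong α) ∨ -α ∈ S.filter (fun α => M.IsLong α)}) ∧
    ({α : V | α ∈ S.filter (fun α => M.IsLong α) ∨ -α ∈ S.filter (fun α => M.IsLong α)} =
        {α : V | α ∈ M.Φ ∧ M.IsLong α} ∩ M.PhiSet S ∧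
      {α : V | α ∈ S.filter (fun α => ¬ M.IsLong α) ∨ -α ∈ S.filter (fun α => ¬ M.IsLong α)} =
        {α ∈ M.PhiSet S | ∀ β ∈ S.filter (fun α => M.IsLong α), (⟪α, β⟫ : ℝ) = 0}) ∧
    ({α : V | α ∈ M.Pos ∧ ∃ c : V → ℤ, α = ∑ β ∈ S, (c β : ℝ) • β} = (↑S : Set V)) := by
  have subl : S.filter (fun α => M.IsLong α) ⊆ S := Finset.filter_subset _ _
  have subs : S.filter (fun α => ¬ M.IsLong α) ⊆ S := Finset.filter_subset _ _
  have hSl := (Finset.coe_subset.mpr subl).trans hS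
  have hSs := (Finset.coe_subset.mpr subs).trans hS
  have hol := horth.mono subl
  have hos := horth.mono subs
  have mixed : ∀ β ∈ S.filter (fun α => ¬ M.IsLong α), ∀ γ ∈ S.filter (fun α => M.IsLong α),
      (⟪β, γ⟫ : ℝ) = 0 := by
    intro β hβ γ hγ
    rw [Finset.mem_filter] at hβ hγ
    exact horth hβ.1 hγ.1 fun h => hβ.2 (h ▸ hγ.2)
  refine ⟨⟨?_, ?_⟩, ?_, ?_, ⟨?_, ?_⟩, ?_⟩
  · apply Set.Subset.antisymm
    · intro α hα
      rcases M.PhiSet_cases hS horth hα with h | ⟨-, h, -⟩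
      · by_cases hl : M.IsLong α
        · refine Or.inl (M.mem_PhiSet_of_mem_or_neg_mem hSl hol ?_)
          simpa [Finset.mem_filter, M.isLong_neg, hl] using h
        · refine Or.inr (M.mem_PhiSet_of_mem_or_neg_mem hSs hos ?_)
          simpa [Finset.mem_filter, M.isLong_neg, hl] using h
      · exact Or.inl h
    · exact Set.union_subset (M.PhiSet_mono hS horth subl) (M.PhiSet_mono hS horth subs)
  · rw [Set.disjoint_left]
    intro α h1 h2
    rw [M.mem_PhiSet_iff hSl hol] at h1
    rw [M.mem_PhiSet_iff hSs hos] at h2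
    have hperp : Submodule.span ℝ (↑(S.filter fun α => ¬ M.IsLong α) : Set V) ⟂
        Submodule.span ℝ (↑(S.filter fun α => M.IsLong α) : Set V) :=
      Submodule.isOrtho_span.mpr fun β hβ γ hγ => mixed β hβ γ hγ
    exact (M.inner_self_pos h1.1).ne' (Submodule.isOrtho_iff_inner_eq.mp hperp α h2.2 α h1.2)
  · ext α
    refine ⟨fun hα => ?_, M.mem_PhiSet_of_mem_or_neg_mem hSs hos⟩
    rcases M.PhiSet_cases hSs hos hα with h | ⟨-, -, β, hβ, hl, -⟩
    · exact h
    · exact absurd hl (Finset.mem_filter.mp hβ).2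
  · ext α
    constructor
    · rintro ⟨hα, -, hl⟩
      rcases M.PhiSet_cases hSl hol hα with h | ⟨h, -⟩
      · exact h
      · exact absurd hl h
    · intro hα
      have h := M.mem_PhiSet_of_mem_or_neg_mem hSl hol hα
      refine ⟨h, h.1, ?_⟩
      rcases hα with h | h
      · exact (Finset.mem_filter.mp h).2
      · exact M.isLong_neg.mp (Finset.mem_filter.mp h).2
  · ext α
    constructor
    · intro hα
      have h := M.mem_PhiSet_of_mem_or_neg_mem hSl hol hα
      refine ⟨⟨h.1, ?_⟩, M.PhiSet_mono hS horth subl h⟩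
      rcases hα with h | h
      · exact (Finset.mem_filter.mp h).2
      · exact M.isLong_neg.mp (Finset.mem_filter.mp h).2
    · rintro ⟨⟨-, hl⟩, hα⟩
      rcases M.PhiSet_cases hS horth hα with h | ⟨h, -⟩
      · simpa [Finset.mem_filter, M.isLong_neg, hl] using h
      · exact absurd hl h
  · ext α
    constructor
    · intro hα
      refine ⟨M.PhiSet_mono hS horth subs (M.mem_PhiSet_of_mem_or_neg_mem hSs hos hα), ?_⟩
      intro β hβ
      rcases hα with h | h
      · exact mixed α h β hβ
      · have := mixed _ h β hβ
        rwa [inner_neg_left, neg_eq_zero] at this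
    · rintro ⟨hα, hperp⟩
      rcases M.PhiSet_cases hS horth hα with h | ⟨-, -, β, hβ, hl, hne⟩
      · have hl : ¬ M.IsLong α := by
          intro hl
          apply (M.inner_self_pos hα.1).ne'
          rcases h with h | h
          · exact hperp α (Finset.mem_filter.mpr ⟨h, hl⟩)
          · have := hperp (-α) (Finset.mem_filter.mpr ⟨h, M.isLong_neg.mpr hl⟩)
            rwa [inner_neg_right, neg_eq_zero] at this
        simpa [Finset.mem_filter, M.isLong_neg, hl] using h
      · exact absurd (hperp β (Finset.mem_filter.mpr ⟨hβ, hl⟩)) hne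
  · ext α
    constructor
    · rintro ⟨hpos, c, hc⟩
      rcases M.root_in_span_cases hS horth (fun β => (c β : ℝ)) hpos.1 hc with
        ⟨β, hβ, rfl | rfl⟩ | ⟨β, hβ, β', hβ', -, -, -, hhalf, -⟩
      · exact hβ
      · obtain ⟨f, hf1, hf2, -⟩ := M.exists_coeff_functional
        have h := hf2 _ hpos
        rw [map_neg, hf1 β (hS hβ)] at h
        norm_num at h
      · have h1 : ((2 * |c β| : ℤ) : ℝ) = (1 : ℤ) := by
          push_cast
          linarith
        have h2 : 2 * |c β| = 1 := by exact_mod_cast h1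
        omega
    · intro hα
      obtain ⟨hΦ, d, hd, -⟩ := hS hα
      refine ⟨⟨hΦ, d, hd⟩, fun β => if β = α then 1 else 0, ?_⟩
      rw [Finset.sum_eq_single_of_mem α hα]
      · simp
      · intro β _ hne
        simp [hne]
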